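/- Identifiability of the full graph (Theorem 1, uniqueness): Let G = (V, E) and G' = (V, E') be two DAGs with self-loops on the same finite vertex set V, with lifted graphs G̃ and G̃' (which share the vertex set Ṽ = V₀ ⊔ V₁). If G̃ and G̃' induce the same d-separation relation, i.e., for all vertices a, b ∈ Ṽ and all C ⊆ Ṽ \ {a, b}, a and b are d-separated given C in G̃ if and only if they are d-separated given C in G̃', then E = E'. -/

import Mathlib

open Sum

/-- `G = (V, E)` is a DAG with self-loops: every directed cycle stays at a single
vertex, i.e., is a self-loop. -/
def IsDAGWithLoops {V : Type*} (E : V → V → Prop) : Prop :=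
  ∀ (k : ℕ) (w : ℕ → V), 1 ≤ k → w k = w 0 →
    (∀ l < k, E (w l) (w (l + 1))) → ∀ l ≤ k, w l = w 0

/-- The edge relation of the lifted graph `G̃` on `Ṽ = V₀ ⊔ V₁` (`inl i = i₀`,
`inr i = i₁`): `i₀ → i₁` for every self-loop `i → i`, and `i₀ → j₀`, `i₁ → j₁`,
`i₀ → j₁` for every edge `i → j` with `i ≠ j`. -/
def liftedEdge {V : Type*} (E : V → V → Prop) : V ⊕ V → V ⊕ V → Prop
  | .inl i, .inl j => i ≠ j ∧ E i j
  | .inl i, .inr j => (i = j ∧ E i i) ∨ (i ≠ j ∧ E i j)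
  | .inr i, .inr j => i ≠ j ∧ E i j
  | .inr _, .inl _ => False

/-- The parents of `j`: `pa(j) = {i : (i → j) ∈ E}`. -/
def parents {V : Type*} (E : V → V → Prop) (j : V) : Set V := {i | E i j}


/-- `v 0, …, v m` is a path between `a` and `b` in the directed graph with edge
relation `F`: at least one edge (`m ≥ 1`, i.e. at least two vertices), endpoints
`a` and `b`, pairwise distinct vertices, and consecutive vertices joined by an
edge in one direction or the other. -/
def IsPath {W : Type*} (F : W → W → Prop) (a b : W) (m : ℕ) (v : ℕ → W) : Prop :=
  1 ≤ m ∧ v 0 = a ∧ v m = b ∧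
  (∀ l ≤ m, ∀ l' ≤ m, v l = v l' → l = l') ∧
  (∀ l < m, F (v l) (v (l + 1)) ∨ F (v (l + 1)) (v l))

/-- The interior vertex `v l` is a collider on the path `v`. -/
def IsCollider {W : Type*} (F : W → W → Prop) (v : ℕ → W) (l : ℕ) : Prop :=
  F (v (l - 1)) (v l) ∧ F (v (l + 1)) (v l)

/-- The path `v 0, …, v m` is blocked by the conditioning set `C`: it contains an
interior non-collider vertex belonging to `C`, or an interior collider vertex
none of whose descendants (via `Relation.ReflTransGen F`) belongs to `C`. -/
def Blocked {W : Type*} (F : W → W → Prop) (C : Set W) (m : ℕ) (v : ℕ → W) : Prop :=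
  ∃ l, 0 < l ∧ l < m ∧
    ((¬ IsCollider F v l ∧ v l ∈ C) ∨
      (IsCollider F v l ∧ ∀ u, Relation.ReflTransGen F (v l) u → u ∉ C))

/-- `a` and `b` are d-separated given `C`: every path between them is blocked. -/
def DSep {W : Type*} (F : W → W → Prop) (a b : W) (C : Set W) : Prop :=
  ∀ (m : ℕ) (v : ℕ → W), IsPath F a b m v → Blocked F C m v

/-- The vertex sets `A` and `B` are d-separated given `C`. -/
def DSepSet {W : Type*} (F : W → W → Prop) (A B C : Set W) : Prop :=
  ∀ a ∈ A, ∀ b ∈ B, DSep F a b C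


theorem aux_seq {V : Type*} (E : V → V → Prop) {a b : V} (h : Relation.ReflTransGen E a b) :
    ∃ (k : ℕ) (w : ℕ → V), w 0 = a ∧ w k = b ∧ ∀ l < k, E (w l) (w (l + 1)) := by
  induction h with
  | refl => exact ⟨0, fun _ => a, rfl, rfl, by simp⟩
  | @tail b c _ hbc ih =>
    obtain ⟨k, w, h0, hk, hw⟩ := ih
    refine ⟨k + 1, fun n => if n ≤ k then w n else c, by simpa using h0, by simp, ?_⟩
    intro l hl
    by_cases h : l = k
    · subst h
      simpa [hk] using hbc
    · have h1 : l ≤ k := by omega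
      have h2 : l + 1 ≤ k := by omega
      simpa [h1, h2] using hw l (by omega)

theorem aux_cycle {V : Type*} (E : V → V → Prop) (hG : IsDAGWithLoops E) {a b : V}
    (hab : E a b) (hba : Relation.ReflTransGen E b a) : a = b := by
  obtain ⟨k, w, h0, hk, hw⟩ := aux_seq E hba
  have := hG (k + 1) (fun n => if n ≤ k then w n else b) (by omega) (by simp [h0]) (by
    intro l hl
    by_cases h : l = k
    · subst h
      simpa [hk] using hab
    · have h1 : l ≤ k := by omega
      have h2 : l + 1 ≤ k := by omega
      simpa [h1, h2] using hw l (by omega)) k (by omega)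
  simpa [hk, h0] using this

theorem aux_proj {V : Type*} (E : V → V → Prop) (a b : V ⊕ V) (h : liftedEdge E a b) :
    E (Sum.elim id id a) (Sum.elim id id b) := by
  rcases a with a | a <;> rcases b with b | b <;> simp only [liftedEdge] at h <;> simp
  · exact h.2
  · rcases h with ⟨rfl, h⟩ | h
    · exact h
    · exact h.2
  · exact h.2

theorem aux_inr {V : Type*} (E : V → V → Prop) {j : V} {b : V ⊕ V}
    (h : Relation.ReflTransGen (liftedEdge E) (Sum.inr j) b) : ∃ x, b = Sum.inr x := by
  induction h with
  | refl => exact ⟨j, rfl⟩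
  | @tail b c _ hbc ih =>
    obtain ⟨x, rfl⟩ := ih
    rcases c with c | c
    · exact hbc.elim
    · exact ⟨c, rfl⟩

theorem aux_acyc {V : Type*} (E : V → V → Prop) (hG : IsDAGWithLoops E) {j : V} {b : V ⊕ V}
    (h : liftedEdge E (Sum.inr j) b)
    (h' : Relation.ReflTransGen (liftedEdge E) b (Sum.inr j)) : False := by
  have h1 := aux_cycle E hG (aux_proj E _ _ h) (Relation.ReflTransGen.lift _ (aux_proj E) _ _ h')
  rcases b with b | b
  · exact h.elim
  · exact h.1 h1

theorem aux_dsep {V : Type*} (E : V → V → Prop) (hG : IsDAGWithLoops E) (i j : V)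
    (hij : ¬ E i j) :
    DSep (liftedEdge E) (Sum.inl i) (Sum.inr j) {u | liftedEdge E u (Sum.inr j)} := by
  classical
  intro m v ⟨hm, h0, hmb, _, hadj⟩
  have hnadj : ¬ liftedEdge E (Sum.inl i) (Sum.inr j) := fun h => hij (aux_proj E _ _ h)
  obtain ⟨n, rfl⟩ : ∃ n, m = n + 1 := ⟨m - 1, by omega⟩
  have hP : ∃ l, l ≤ n + 1 ∧ ∀ k, l ≤ k → k < n + 1 → liftedEdge E (v (k + 1)) (v k) :=
    ⟨n + 1, le_rfl, fun k _ _ => by omega⟩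
  obtain ⟨hl, hk⟩ := Nat.find_spec hP
  have hmin := fun t => @Nat.find_min _ _ hP t
  generalize Nat.find hP = l at hl hk hmin
  have hreach : ∀ d, ∀ k, k + d = n + 1 → l ≤ k →
      Relation.ReflTransGen (liftedEdge E) (Sum.inr j) (v k) := by
    intro d
    induction d with
    | zero => intro k h _; have : k = n + 1 := by omega
              subst this; rw [hmb]
    | succ d ih => intro k h hlk
                   exact (ih (k + 1) (by omega) (by omega)).tail (hk k hlk (by omega))
  have hl0 : l ≠ 0 := by
    rintro rfl
    obtain ⟨x, hx⟩ := aux_inr E (hreach (n + 1) 0 (by omega) le_rfl)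
    rw [h0] at hx
    cases hx
  obtain ⟨p, rfl⟩ : ∃ p, l = p + 1 := ⟨l - 1, by omega⟩
  have hp : liftedEdge E (v p) (v (p + 1)) := by
    rcases hadj p (by omega) with h | h
    · exact h
    · exfalso
      refine hmin p (by omega) ⟨by omega, fun k h1 h2 => ?_⟩
      by_cases hkp : k = p
      · subst hkp; exact h
      · exact hk k (by omega) h2
  by_cases hpn : p = n
  · subst hpn
    rw [hmb] at hp
    have hp0 : p ≠ 0 := by
      rintro rfl
      rw [h0] at hp
      exact hnadj hp
    refine ⟨p, by omega, by omega, Or.inl ⟨fun hc => ?_, hp⟩⟩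
    have := hc.2
    rw [hmb] at this
    exact aux_acyc E hG this (.single hp)
  · have hc := hk (p + 1) le_rfl (by omega)
    refine ⟨p + 1, by omega, by omega, Or.inr ⟨⟨hp, hc⟩, fun u hu huC => ?_⟩⟩
    obtain ⟨x, hx⟩ := aux_inr E (hreach (n - p - 1) (p + 1 + 1) (by omega) (by omega))
    have h1 := hreach (n - p - 1) (p + 1 + 1) (by omega) (by omega)
    rw [hx] at hc h1
    exact aux_acyc E hG hc ((hu.tail huC).trans h1)

theorem aux_main {V : Type*} (E E' : V → V → Prop) (hG : IsDAGWithLoops E)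
    (hsep : ∀ (a b : V ⊕ V) (C : Set (V ⊕ V)), a ∉ C → b ∉ C →
      (DSep (liftedEdge E) a b C ↔ DSep (liftedEdge E') a b C)) (i j : V) (h : E' i j) :
    E i j := by
  by_contra hij
  have hd := (hsep (Sum.inl i) (Sum.inr j) {u | liftedEdge E u (Sum.inr j)}
    (fun h => hij (aux_proj E (Sum.inl i) (Sum.inr j) h)) (fun h => h.1 rfl)).1 (aux_dsep E hG i j hij)
  have he : liftedEdge E' (Sum.inl i) (Sum.inr j) := by
    by_cases hh : i = j
    · subst hh; exact Or.inl ⟨rfl, h⟩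
    · exact Or.inr ⟨hh, h⟩
  obtain ⟨l, h1, h2, _⟩ := hd 1 (fun n => if n = 0 then Sum.inl i else Sum.inr j)
    ⟨le_rfl, by simp, by simp, by
      intro l hl l' hl' h
      have a1 : l = 0 ∨ l = 1 := by omega
      have a2 : l' = 0 ∨ l' = 1 := by omega
      rcases a1 with rfl | rfl <;> rcases a2 with rfl | rfl <;> simp at h ⊢, by
      intro l hl
      have : l = 0 := by omega
      subst this
      left
      simpa using he⟩
  omega

/-- identifiability of the full graph; Theorem 1, uniqueness.
If two DAGs with self-loops on the same finite vertex set have lifted graphs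
inducing the same d-separation relation, then they have the same edges. -/
theorem eq_of_lifted_dsep_eq {V : Type*} [Fintype V] (E E' : V → V → Prop)
    (hG : IsDAGWithLoops E) (hG' : IsDAGWithLoops E')
    (hsep : ∀ (a b : V ⊕ V) (C : Set (V ⊕ V)), a ∉ C → b ∉ C →
      (DSep (liftedEdge E) a b C ↔ DSep (liftedEdge E') a b C)) :
    E = E' := by
  funext i j
  exact propext ⟨aux_main E' E hG' (fun a b C ha hb => (hsep a b C ha hb).symm) i j,
    aux_main E E' hG hsep i j⟩
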